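/- arXiv:1812.01574 — 3 statements merged into one kernel-verified Lean document; each statement's English description precedes it below -/
import Mathlib

section
/- Let n, r be natural numbers with 1 ≤ r < n. Let Φ ∈ ℝ^{n×r}, Ψ ∈ ℝ^{n×r}, and let B̂ ∈ ℝ^{n×r} be such that the r×r matrix B̂ᵀΦ is invertible. Define the projection P_B := Φ (B̂ᵀΦ)⁻¹ B̂ᵀ ∈ ℝ^{n×n}. Then for every z ∈ ℝⁿ, with z⋆ := Φ Ψᵀ z, one has ‖z − P_B z‖₂ ≤ ‖Φ‖₂ · ‖(B̂ᵀΦ)⁻¹‖₂ · ‖B̂ᵀ‖₂ · ‖z − z⋆‖₂. -/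
open Matrix

/-- Spectral norm (ℓ₂→ℓ₂ operator norm) of a real matrix. -/
noncomputable def specNorm {m n : ℕ} (M : Matrix (Fin m) (Fin n) ℝ) : ℝ :=
  ‖LinearMap.toContinuousLinearMap (Matrix.toEuclideanLin M)‖

/-- Euclidean norm of a vector in ℝⁿ. -/
noncomputable def euclNorm {n : ℕ} (x : Fin n → ℝ) : ℝ :=
  ‖(EuclideanSpace.equiv (Fin n) ℝ).symm x‖

/-- A nonzero idempotent operator has norm at least one. -/
theorem IsIdempotentElem.one_le_opNorm {E : Type*} [NormedAddCommGroup E] [NormedSpace ℝ E]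
    {P : E →L[ℝ] E} (hP : IsIdempotentElem P) (h0 : P ≠ 0) : 1 ≤ ‖P‖ := by
  have h : ‖P‖ ≤ ‖P‖ * ‖P‖ := by
    simpa only [hP.eq] using norm_mul_le P P
  exact le_of_mul_le_mul_right (by simpa using h) (norm_pos_iff.mpr h0)

/-- On an inner product space, the complement of a nonzero idempotent operator `P` is bounded
by the norm of `P`. -/
theorem IsIdempotentElem.norm_sub_apply_le {E : Type*} [NormedAddCommGroup E]
    [InnerProductSpace ℝ E] {P : E →L[ℝ] E} (hP : IsIdempotentElem P) (h0 : P ≠ 0) (w : E) :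
    ‖w - P w‖ ≤ ‖P‖ * ‖w‖ := by
  have hPP : P (P w) = P w := congrArg (fun Q : E →L[ℝ] E => Q w) hP.eq
  by_cases hu : P w = 0
  · rw [hu, sub_zero]
    exact le_mul_of_one_le_left (norm_nonneg w) (hP.one_le_opNorm h0)
  by_cases hv : w - P w = 0
  · rw [hv, norm_zero]
    positivity
  obtain ⟨u, hu_def⟩ : ∃ u, u = P w := ⟨_, rfl⟩
  obtain ⟨v, hv_def⟩ : ∃ v, v = w - P w := ⟨_, rfl⟩
  have hPu : P u = u := by rw [hu_def, hPP]
  have hPv : P v = 0 := by rw [hv_def, map_sub, hPP, sub_self]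
  have hw : w = u + v := by rw [hu_def, hv_def]; abel
  rw [← hu_def] at hu
  rw [← hv_def] at hv ⊢
  have ha : ‖u‖ ≠ 0 := norm_ne_zero_iff.mpr hu
  have hb : ‖v‖ ≠ 0 := norm_ne_zero_iff.mpr hv
  -- Swapping the lengths of the two components preserves the norm of their sum.
  have hx : ‖(‖v‖ / ‖u‖) • u + (‖u‖ / ‖v‖) • v‖ = ‖w‖ := by
    rw [← sq_eq_sq₀ (norm_nonneg _) (norm_nonneg _), hw, norm_add_sq_real, norm_add_sq_real,
      norm_smul, norm_smul, real_inner_smul_left, real_inner_smul_right, norm_div, norm_div,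
      norm_norm, norm_norm]
    field_simp
    ring
  have hPx : ‖P ((‖v‖ / ‖u‖) • u + (‖u‖ / ‖v‖) • v)‖ = ‖v‖ := by
    rw [map_add, map_smul, map_smul, hPu, hPv, smul_zero, add_zero, norm_smul, norm_div,
      norm_norm, norm_norm, div_mul_cancel₀ _ ha]
  rw [← hPx, ← hx]
  exact P.le_opNorm _

/-- The spectral norm is submultiplicative. -/
theorem specNorm_mul_le {l m n : ℕ} (M : Matrix (Fin l) (Fin m) ℝ)
    (N : Matrix (Fin m) (Fin n) ℝ) : specNorm (M * N) ≤ specNorm M * specNorm N := by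
  have h : LinearMap.toContinuousLinearMap (Matrix.toEuclideanLin (M * N)) =
      (LinearMap.toContinuousLinearMap (Matrix.toEuclideanLin M)).comp
        (LinearMap.toContinuousLinearMap (Matrix.toEuclideanLin N)) := by
    ext x i
    simp [Matrix.toLpLin_apply, Matrix.mulVec_mulVec]
  rw [specNorm, h]
  exact ContinuousLinearMap.opNorm_comp_le _ _

/-- The complement of a nonzero idempotent matrix `P` is bounded by the spectral norm of `P`. -/
theorem euclNorm_sub_mulVec_le {n : ℕ} {P : Matrix (Fin n) (Fin n) ℝ} (hP : IsIdempotentElem P)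
    (h0 : P ≠ 0) (w : Fin n → ℝ) : euclNorm (w - P.mulVec w) ≤ specNorm P * euclNorm w := by
  have hQ : IsIdempotentElem (LinearMap.toContinuousLinearMap (Matrix.toEuclideanLin P)) := by
    ext x i
    simp [Matrix.toLpLin_apply, Matrix.mulVec_mulVec, hP.eq]
  have hQ0 : LinearMap.toContinuousLinearMap (Matrix.toEuclideanLin P) ≠ 0 := by
    simpa using h0
  exact hQ.norm_sub_apply_le hQ0 (WithLp.toLp 2 w)

/-- Interpolation error bound for the oblique projector `P_B = Φ (B̂ᵀΦ)⁻¹ B̂ᵀ`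
on the adjoint state. -/
theorem interp_error_bound_actuators {n r : ℕ} (hr : 1 ≤ r) (hrn : r < n)
    (Φ Ψ : Matrix (Fin n) (Fin r) ℝ) (Bhat : Matrix (Fin n) (Fin r) ℝ)
    (hinv : IsUnit (Bhatᵀ * Φ))
    (PB : Matrix (Fin n) (Fin n) ℝ) (hPB : PB = Φ * (Bhatᵀ * Φ)⁻¹ * Bhatᵀ)
    (z zstar : Fin n → ℝ) (hzstar : zstar = Φ.mulVec (Ψᵀ.mulVec z)) :
    euclNorm (z - PB.mulVec z) ≤
      specNorm Φ * specNorm (Bhatᵀ * Φ)⁻¹ * specNorm Bhatᵀ * euclNorm (z - zstar) := by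
  have hdet : IsUnit (Bhatᵀ * Φ).det := (Matrix.isUnit_iff_isUnit_det _).mp hinv
  have hPΦ : PB * Φ = Φ := by
    rw [hPB, Matrix.mul_assoc, Matrix.mul_assoc, Matrix.nonsing_inv_mul _ hdet, Matrix.mul_one]
  have hidem : IsIdempotentElem PB := by
    change PB * PB = PB
    nth_rewrite 2 [hPB]
    rw [← Matrix.mul_assoc, ← Matrix.mul_assoc, hPΦ, ← hPB]
  have h0 : PB ≠ 0 := by
    rintro rfl
    have : Nonempty (Fin r) := ⟨⟨0, hr⟩⟩
    rw [← hPΦ, Matrix.zero_mul, Matrix.mul_zero] at hinv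
    exact not_isUnit_zero hinv
  have hfix : PB.mulVec zstar = zstar := by
    rw [hzstar, Matrix.mulVec_mulVec, hPΦ]
  have hsub : z - PB.mulVec z = (z - zstar) - PB.mulVec (z - zstar) := by
    rw [Matrix.mulVec_sub, hfix]
    abel
  have hnorm : specNorm PB ≤ specNorm Φ * specNorm (Bhatᵀ * Φ)⁻¹ * specNorm Bhatᵀ := by
    rw [hPB]
    exact (specNorm_mul_le _ _).trans
      (mul_le_mul_of_nonneg_right (specNorm_mul_le _ _) (norm_nonneg _))
  rw [hsub]
  exact (euclNorm_sub_mulVec_le hidem h0 _).trans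
    (mul_le_mul_of_nonneg_right hnorm (norm_nonneg _))
end

section
/- Let H be a real (or complB ex) Hilbert space and let P : H → H be a continuous linear idempotent (P ∘ P = P) with P ≠ 0 and P ≠ id. Then ‖id − P‖ = ‖P‖, where ‖·‖ is the operator norm. -/
lemma norm_sq_smul_add_norm_sq_smul {E : Type*} [NormedAddCommGroup E] [InnerProductSpace ℝ E]
    (u v : E) : ‖‖v‖ ^ 2 • u + ‖u‖ ^ 2 • v‖ = ‖u‖ * ‖v‖ * ‖u + v‖ := by
  rw [← sq_eq_sq₀ (by positivity) (by positivity), mul_pow, norm_add_sq_real, norm_add_sq_real]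
  simp only [norm_smul, real_inner_smul_left, real_inner_smul_right, norm_pow, norm_norm]
  ring

lemma IsIdempotentElem.one_le_norm_of_ne_zero {R : Type*} [NonUnitalNormedRing R] {p : R}
    (hp : IsIdempotentElem p) (h0 : p ≠ 0) : 1 ≤ ‖p‖ := by
  have h := norm_mul_le p p
  rw [hp.eq] at h
  exact le_of_mul_le_mul_right (by simpa using h) (norm_pos_iff.mpr h0)

lemma ContinuousLinearMap.norm_le_norm_one_sub_of_isIdempotentElem {E : Type*}
    [NormedAddCommGroup E] [InnerProductSpace ℝ E] {P : E →L[ℝ] E} (hP : IsIdempotentElem P)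
    (h1 : P ≠ 1) : ‖P‖ ≤ ‖1 - P‖ := by
  have hPP (x : E) : P (P x) = P x := congr($hP x)
  refine P.opNorm_le_bound (norm_nonneg _) fun x ↦ ?_
  obtain hu | hu := eq_or_ne (P x) 0
  · rw [hu, norm_zero]
    positivity
  obtain hv | hv := eq_or_ne (x - P x) 0
  · rw [← sub_eq_zero.mp hv]
    exact le_mul_of_one_le_left (norm_nonneg x)
      (hP.one_sub.one_le_norm_of_ne_zero (sub_ne_zero.mpr h1.symm))
  have h := (1 - P).le_opNorm (‖x - P x‖ ^ 2 • P x + ‖P x‖ ^ 2 • (x - P x))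
  have hQ : (1 - P) (‖x - P x‖ ^ 2 • P x + ‖P x‖ ^ 2 • (x - P x)) = ‖P x‖ ^ 2 • (x - P x) := by
    simp [hPP]
  rw [hQ, norm_sq_smul_add_norm_sq_smul, add_sub_cancel, norm_smul, norm_pow, norm_norm] at h
  have hpos : 0 < ‖P x‖ * ‖x - P x‖ := mul_pos (norm_pos_iff.mpr hu) (norm_pos_iff.mpr hv)
  refine le_of_mul_le_mul_left ?_ hpos
  linarith

/-- In a real Hilbert space, a nonzero, non-identity bounded idempotent operator
(an oblique projection) satisfies `‖id − P‖ = ‖P‖`. -/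
theorem norm_id_sub_proj_eq_norm_proj
    {H : Type*} [NormedAddCommGroup H] [InnerProductSpace ℝ H] [CompleteSpace H]
    (P : H →L[ℝ] H) (hidem : P.comp P = P)
    (h0 : P ≠ 0) (hid : P ≠ ContinuousLinearMap.id ℝ H) :
    ‖ContinuousLinearMap.id ℝ H - P‖ = ‖P‖ := by
  have hP : IsIdempotentElem P := hidem
  refine le_antisymm ?_ (ContinuousLinearMap.norm_le_norm_one_sub_of_isIdempotentElem hP hid)
  simpa [ContinuousLinearMap.one_def] using
    ContinuousLinearMap.norm_le_norm_one_sub_of_isIdempotentElem hP.one_sub (by simpa using h0)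
end

section
/- (Drmac–Gugercin bound for QR column pivoting.) Let U ∈ ℝ^{p×r} have full column rank r ≤ p, and suppose Uᵀ admits a pivoted QR factorization Uᵀ P = Q R, where P ∈ ℝ^{p×p} is a permutation matrix, Q ∈ ℝ^{r×r} is orthogonal, and R ∈ ℝ^{r×p} is upper triangular (R_{jk} = 0 for j > k) satisfying the Businger–Golub diagonal dominance property. Let S ∈ ℝ^{r×p} be the row-selection matrix formed by transposing the first r columns of P, so that (S U)ᵀ equals the leading r×r block of Uᵀ P. Then S U is invertible and ‖(S U)⁻¹‖₂ ≤ (√(p − r + 1) / σ_min(U)) · (√(4^r + 6r − 1) / 3). -/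
open Matrix

/-- Smallest singular value of a matrix: the infimum of `‖Ux‖₂` over the unit sphere. -/
noncomputable def sigmaMin {p r : ℕ} (U : Matrix (Fin p) (Fin r) ℝ) : ℝ :=
  sInf {c : ℝ | ∃ x : Fin r → ℝ, euclNorm x = 1 ∧ c = euclNorm (U.mulVec x)}

/-- A permutation matrix: exactly one entry 1 in each row and column, zeros elsewhere. -/
def IsPermMatrix {p : ℕ} (P : Matrix (Fin p) (Fin p) ℝ) : Prop :=
  ∃ σ : Equiv.Perm (Fin p), P = σ.permMatrix ℝ

/-- Upper triangular (possibly rectangular) matrix: `R j k = 0` for `j > k`. -/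
def IsUpperTri {r p : ℕ} (R : Matrix (Fin r) (Fin p) ℝ) : Prop :=
  ∀ (j : Fin r) (k : Fin p), (k : ℕ) < (j : ℕ) → R j k = 0

/-- Businger–Golub diagonal dominance:
`|R i i|² ≥ Σ_{j=i}^{min(k,r)} |R j k|²` for all `i ≤ k`. -/
def BusingerGolub {r p : ℕ} (R : Matrix (Fin r) (Fin p) ℝ) : Prop :=
  ∀ (i : Fin r) (ip : Fin p) (k : Fin p), (i : ℕ) = (ip : ℕ) → (ip : ℕ) ≤ (k : ℕ) →
    (∑ j : Fin r, if (i : ℕ) ≤ (j : ℕ) ∧ (j : ℕ) ≤ (k : ℕ) then (R j k) ^ 2 else 0)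
      ≤ (R i ip) ^ 2

lemma euclNorm_eq_sqrt {n : ℕ} (x : Fin n → ℝ) : euclNorm x = √(x ⬝ᵥ x) := by
  simp [euclNorm, EuclideanSpace.norm_eq, dotProduct, sq]

lemma euclNorm_sq {n : ℕ} (x : Fin n → ℝ) : euclNorm x ^ 2 = x ⬝ᵥ x := by
  rw [euclNorm_eq_sqrt, Real.sq_sqrt]
  exact Finset.sum_nonneg fun i _ => mul_self_nonneg _

lemma euclNorm_nonneg {n : ℕ} (x : Fin n → ℝ) : 0 ≤ euclNorm x := norm_nonneg _

lemma euclNorm_mulVec_of_transpose_mul_self {m n : ℕ} {Q : Matrix (Fin m) (Fin n) ℝ}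
    (hQ : Qᵀ * Q = 1) (x : Fin n → ℝ) : euclNorm (Q *ᵥ x) = euclNorm x := by
  rw [euclNorm_eq_sqrt, euclNorm_eq_sqrt, dotProduct_mulVec, ← mulVec_transpose, mulVec_mulVec,
    hQ, one_mulVec]

lemma specNorm_le_of_euclNorm_le {m n : ℕ} {M : Matrix (Fin m) (Fin n) ℝ} {C : ℝ} (hC : 0 ≤ C)
    (h : ∀ x, euclNorm (M *ᵥ x) ≤ C * euclNorm x) : specNorm M ≤ C :=
  ContinuousLinearMap.opNorm_le_bound _ hC fun x => h x.ofLp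

lemma sigmaMin_le {p r : ℕ} (U : Matrix (Fin p) (Fin r) ℝ) {x : Fin r → ℝ}
    (hx : euclNorm x = 1) : sigmaMin U ≤ euclNorm (U *ᵥ x) := by
  refine csInf_le ⟨0, ?_⟩ ⟨x, hx, rfl⟩
  rintro _ ⟨y, -, rfl⟩
  exact euclNorm_nonneg _

lemma sigmaMin_pos {p r : ℕ} (hr : 1 ≤ r) (U : Matrix (Fin p) (Fin r) ℝ) (hU : U.rank = r) :
    0 < sigmaMin U := by
  have hinj : Function.Injective U.mulVec := by
    rw [mulVec_injective_iff]
    rw [linearIndependent_iff_card_eq_finrank_span, Set.finrank, ← rank_eq_finrank_span_cols, hU,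
      Fintype.card_fin]
  have hinj' : LinearMap.ker (toEuclideanLin U) = ⊥ := by
    rw [LinearMap.ker_eq_bot]
    intro x y hxy
    exact WithLp.ofLp_injective 2 (hinj (congrArg WithLp.ofLp hxy))
  obtain ⟨K, hK, hanti⟩ := LinearMap.exists_antilipschitzWith (toEuclideanLin U) hinj'
  have hKpos : (0 : ℝ) < K := hK
  refine lt_of_lt_of_le (inv_pos.mpr hKpos) (le_csInf ?_ ?_)
  · refine ⟨_, Pi.single ⟨0, hr⟩ 1, ?_, rfl⟩
    simp [euclNorm_eq_sqrt]
  · rintro _ ⟨x, hx, rfl⟩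
    have h : euclNorm x ≤ K * euclNorm (U *ᵥ x) :=
      hanti.le_mul_norm (map_zero (toEuclideanLin U)) (WithLp.toLp 2 x)
    rw [hx] at h
    rwa [inv_le_iff_one_le_mul₀' hKpos]

lemma sq_mul_add_le {s b c B t : ℝ} (hc : 0 ≤ c) (hB : 0 ≤ B) (h : s ^ 2 ≤ c * B) :
    (t * s + b) ^ 2 ≤ (t ^ 2 * c + 1) * (B + b ^ 2) := by
  have key : 2 * t * s * b ≤ B + t ^ 2 * c * b ^ 2 := by
    refine le_of_sq_le_sq ?_ (by positivity)
    have h1 : (t * b) ^ 2 * s ^ 2 ≤ (t * b) ^ 2 * (c * B) :=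
      mul_le_mul_of_nonneg_left h (sq_nonneg _)
    nlinarith [sq_nonneg (B - t ^ 2 * c * b ^ 2)]
  nlinarith [mul_le_mul_of_nonneg_left h (sq_nonneg t)]

/-- Growth of forward substitution with a unit lower triangular matrix whose entries are bounded
by one in absolute value. -/
lemma sum_sq_le_of_le_add_sum_lt (r : ℕ) (a b : Fin r → ℝ) (ha : ∀ i, 0 ≤ a i)
    (h : ∀ i, a i ≤ b i + ∑ j, if j < i then a j else 0) :
    (∑ i, a i) ^ 2 ≤ ((4 : ℝ) ^ r - 1) / 3 * ∑ i, b i ^ 2 ∧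
      ∑ i, a i ^ 2 ≤ ((4 : ℝ) ^ r + 6 * r - 1) / 9 * ∑ i, b i ^ 2 := by
  induction r with
  | zero => simp
  | succ r ih =>
    obtain ⟨hs, hq⟩ := ih (fun i => a i.castSucc) (fun i => b i.castSucc) (fun i => ha _) (by
      intro i
      have hi := h i.castSucc
      rw [Fin.sum_univ_castSucc] at hi
      simpa [Fin.castSucc_lt_castSucc_iff, not_lt.mpr (Fin.le_last _)] using hi)
    have hl := h (Fin.last r)
    rw [Fin.sum_univ_castSucc] at hl
    simp only [Fin.castSucc_lt_last, if_true, lt_irrefl, if_false, add_zero] at hl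
    simp only [Fin.sum_univ_castSucc]
    have hs0 : 0 ≤ ∑ i : Fin r, a i.castSucc := Finset.sum_nonneg fun i _ => ha _
    have hB : 0 ≤ ∑ i : Fin r, b i.castSucc ^ 2 := Finset.sum_nonneg fun i _ => sq_nonneg _
    have hl0 := ha (Fin.last r)
    generalize ∑ i : Fin r, a i.castSucc = s at *
    generalize ∑ i : Fin r, b i.castSucc ^ 2 = B at *
    generalize a (Fin.last r) = x at *
    generalize b (Fin.last r) = y at *
    have h4 : (1 : ℝ) ≤ 4 ^ r := one_le_pow₀ (by norm_num)
    have hc : (0 : ℝ) ≤ (4 ^ r - 1) / 3 := by linarith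
    have e1 := sq_mul_add_le (b := y) (t := 2) hc hB hs
    have e2 := sq_mul_add_le (b := y) (t := 1) hc hB hs
    have f1 : (s + x) ^ 2 ≤ (2 * s + y) ^ 2 :=
      pow_le_pow_left₀ (by linarith) (by linarith) 2
    have f2 : x ^ 2 ≤ (1 * s + y) ^ 2 := pow_le_pow_left₀ hl0 (by linarith) 2
    constructor
    · rw [pow_succ (4 : ℝ) r]
      linarith
    · have hy : 0 ≤ ((4 : ℝ) ^ r + 6 * r - 1) / 9 * y ^ 2 := by
        have : (0 : ℝ) ≤ r := r.cast_nonneg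
        have : (0 : ℝ) ≤ (4 : ℝ) ^ r + 6 * r - 1 := by linarith
        positivity
      rw [pow_succ (4 : ℝ) r]
      push_cast
      linarith

lemma BusingerGolub.sq_le {r p : ℕ} {R : Matrix (Fin r) (Fin p) ℝ} (hR : BusingerGolub R)
    (hrp : r ≤ p) {i j : Fin r} {k : Fin p} (hij : i ≤ j) (hjk : (j : ℕ) ≤ k) :
    R j k ^ 2 ≤ R i (Fin.castLE hrp i) ^ 2 := by
  refine le_trans ?_ (hR i (Fin.castLE hrp i) k rfl (le_trans hij hjk))
  have h := Finset.single_le_sum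
    (f := fun j : Fin r => if (i : ℕ) ≤ j ∧ (j : ℕ) ≤ k then R j k ^ 2 else 0)
    (fun _ _ => by positivity) (Finset.mem_univ j)
  simpa only [if_pos (show (i : ℕ) ≤ j ∧ (j : ℕ) ≤ k from ⟨hij, hjk⟩)] using h

/-- Solving with the transposed leading block of a diagonally dominant triangular matrix. -/
lemma BusingerGolub.sum_sq_le {r p : ℕ} {R : Matrix (Fin r) (Fin p) ℝ} (hR : BusingerGolub R)
    (hT : IsUpperTri R) (hrp : r ≤ p) (l : Fin r) (hl : ∀ i, i ≤ l) (w : Fin r → ℝ) :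
    R l (Fin.castLE hrp l) ^ 2 * ∑ i, w i ^ 2 ≤
      ((4 : ℝ) ^ r + 6 * r - 1) / 9 *
        ∑ k, ((R.submatrix id (Fin.castLE hrp))ᵀ *ᵥ w) k ^ 2 := by
  set y := (R.submatrix id (Fin.castLE hrp))ᵀ *ᵥ w with hy
  have hyk (k : Fin r) : y k = R k (Fin.castLE hrp k) * w k +
      ∑ j, if j < k then R j (Fin.castLE hrp k) * w j else 0 := by
    have h1 : R k (Fin.castLE hrp k) * w k =
        ∑ j, if j = k then R j (Fin.castLE hrp k) * w j else 0 := by simp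
    rw [h1, ← Finset.sum_add_distrib]
    change ∑ j, R j (Fin.castLE hrp k) * w j = _
    refine Finset.sum_congr rfl fun j _ => ?_
    rcases lt_trichotomy j k with h | h | h
    · simp [h, h.ne]
    · simp [h]
    · simp [h.ne', h.not_gt, hT j (Fin.castLE hrp k) h]
  have hsub := (sum_sq_le_of_le_add_sum_lt r (fun i => |R i (Fin.castLE hrp i) * w i|)
    (fun i => |y i|) (fun i => abs_nonneg _) (by
      intro k
      have h1 : R k (Fin.castLE hrp k) * w k =
        y k - ∑ j, if j < k then R j (Fin.castLE hrp k) * w j else 0 := by rw [hyk]; ring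
      simp only [h1]
      refine (abs_sub _ _).trans (add_le_add_right ((Finset.abs_sum_le_sum_abs _ _).trans ?_) _)
      refine Finset.sum_le_sum fun j _ => ?_
      split_ifs with hjk
      · rw [abs_mul, abs_mul]
        exact mul_le_mul_of_nonneg_right
          (sq_le_sq.mp (hR.sq_le hrp le_rfl hjk.le)) (abs_nonneg _)
      · simp)).2
  simp only [sq_abs] at hsub
  refine le_trans ?_ hsub
  rw [Finset.mul_sum]
  refine Finset.sum_le_sum fun i _ => ?_
  rw [mul_pow]
  exact mul_le_mul_of_nonneg_right (hR.sq_le hrp (hl i) le_rfl) (sq_nonneg _)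

lemma BusingerGolub.sum_last_row_sq_le {r p : ℕ} {R : Matrix (Fin r) (Fin p) ℝ}
    (hR : BusingerGolub R) (hT : IsUpperTri R) (hrp : r ≤ p) (l : Fin r) :
    ∑ k, R l k ^ 2 ≤ ((p : ℝ) - l) * R l (Fin.castLE hrp l) ^ 2 := by
  have hcard : ((Finset.univ.filter fun k : Fin p => Fin.castLE hrp l ≤ k).card : ℝ) = p - l := by
    rw [Finset.filter_le_eq_Ici, Fin.card_Ici, Nat.cast_sub (by simp; omega)]
    simp
  rw [← hcard, ← nsmul_eq_mul, ← Finset.sum_const, Finset.sum_filter]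
  refine Finset.sum_le_sum fun k _ => ?_
  split_ifs with h
  · exact hR.sq_le hrp le_rfl h
  · rw [hT l k (by simpa [Fin.le_def] using h)]
    simp

/-- Drmac–Gugercin bound for QR column pivoting: the selected `r×r` submatrix `S U` is
invertible with `‖(S U)⁻¹‖₂ ≤ (√(p−r+1)/σ_min(U)) · (√(4^r+6r−1)/3)`. -/
theorem drmac_gugercin_bound {p r : ℕ} (hr : 1 ≤ r) (hrp : r ≤ p)
    (U : Matrix (Fin p) (Fin r) ℝ) (hrank : U.rank = r)
    (P : Matrix (Fin p) (Fin p) ℝ) (hP : IsPermMatrix P)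
    (Q : Matrix (Fin r) (Fin r) ℝ) (hQ : Qᵀ * Q = 1)
    (R : Matrix (Fin r) (Fin p) ℝ) (hRtri : IsUpperTri R) (hRbg : BusingerGolub R)
    (hQR : Uᵀ * P = Q * R)
    (S : Matrix (Fin r) (Fin p) ℝ)
    (hS : S = Matrix.of fun (i : Fin r) (j : Fin p) => P j (Fin.castLE hrp i)) :
    IsUnit (S * U) ∧
      specNorm (S * U)⁻¹ ≤
        (Real.sqrt ((p : ℝ) - r + 1) / sigmaMin U) *
          (Real.sqrt ((4 : ℝ) ^ r + 6 * r - 1) / 3) := by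
  have hQ' : Q * Qᵀ = 1 := mul_eq_one_comm.mp hQ
  have hPP : Pᵀᵀ * Pᵀ = 1 := by
    obtain ⟨τ, rfl⟩ := hP
    rw [transpose_transpose, transpose_permMatrix, ← permMatrix_mul]
    simp
  set l : Fin r := ⟨r - 1, by omega⟩ with hl
  have hle : ∀ i, i ≤ l := fun i => Fin.le_def.mpr (by simp only [hl]; omega)
  set ρ := R l (Fin.castLE hrp l) with hρ
  have hσ := sigmaMin_pos hr U hrank
  have hPU : Pᵀ * U = Rᵀ * Qᵀ := by
    simpa [transpose_mul] using congrArg transpose hQR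
  have hσρ : sigmaMin U ≤ √((p : ℝ) - r + 1) * |ρ| := by
    have hx : euclNorm (Q *ᵥ Pi.single l 1) = 1 := by
      rw [euclNorm_mulVec_of_transpose_mul_self hQ]
      simp [euclNorm_eq_sqrt]
    refine (sigmaMin_le U hx).trans ?_
    rw [← euclNorm_mulVec_of_transpose_mul_self hPP, mulVec_mulVec, hPU, mulVec_mulVec,
      Matrix.mul_assoc, hQ, Matrix.mul_one, euclNorm_eq_sqrt, ← Real.sqrt_sq_eq_abs,
      ← Real.sqrt_mul' _ (sq_nonneg _)]
    refine Real.sqrt_le_sqrt ?_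
    have h := hRbg.sum_last_row_sq_le hRtri hrp l
    have hlr : (p : ℝ) - (l : ℕ) = p - r + 1 := by
      simp only [hl]
      rw [Nat.cast_sub hr]
      push_cast
      ring
    rw [hlr] at h
    simpa [dotProduct, sq] using h
  have hρ0 : 0 < |ρ| := by
    rcases (abs_nonneg ρ).eq_or_lt with h | h
    · rw [← h, mul_zero] at hσρ
      linarith
    · exact h
  have hSU : S * U = (R.submatrix id (Fin.castLE hrp))ᵀ * Qᵀ := by
    ext i j
    have h := congrFun (congrFun hPU (Fin.castLE hrp i)) j
    rw [hS]
    simpa [mul_apply] using h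
  have h4 : (0 : ℝ) ≤ 4 ^ r + 6 * r - 1 := by
    have : (1 : ℝ) ≤ 4 ^ r := one_le_pow₀ (by norm_num)
    have : (0 : ℝ) ≤ r := r.cast_nonneg
    linarith
  set C := √((4 : ℝ) ^ r + 6 * r - 1) / 3 with hC
  have hC0 : 0 ≤ C := by positivity
  have hbound (x : Fin r → ℝ) : |ρ| * euclNorm x ≤ C * euclNorm ((S * U) *ᵥ x) := by
    have hx : euclNorm x = euclNorm (Qᵀ *ᵥ x) :=
      (euclNorm_mulVec_of_transpose_mul_self (by rwa [transpose_transpose]) x).symm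
    have h := hRbg.sum_sq_le hRtri hrp l hle (Qᵀ *ᵥ x)
    rw [mulVec_mulVec, ← hSU] at h
    refine le_of_sq_le_sq ?_ (mul_nonneg hC0 (euclNorm_nonneg _))
    rw [mul_pow, mul_pow, sq_abs, hx, euclNorm_sq, euclNorm_sq, hC, div_pow, Real.sq_sqrt h4]
    norm_num
    simpa [dotProduct, sq] using h
  have hunit : IsUnit (S * U) := by
    rw [← mulVec_injective_iff_isUnit]
    intro x y hxy
    have h := hbound (x - y)
    rw [mulVec_sub, sub_eq_zero.mpr hxy] at h
    have h0 : euclNorm (0 : Fin r → ℝ) = 0 := by simp [euclNorm_eq_sqrt]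
    rw [h0, mul_zero] at h
    have h1 : euclNorm (x - y) = 0 :=
      le_antisymm (nonpos_of_mul_nonpos_right h hρ0) (euclNorm_nonneg _)
    have h2 := euclNorm_sq (x - y)
    rw [h1, zero_pow two_ne_zero] at h2
    exact sub_eq_zero.mp (dotProduct_self_eq_zero.mp h2.symm)
  refine ⟨hunit, specNorm_le_of_euclNorm_le (by positivity) fun y => ?_⟩
  have h := hbound ((S * U)⁻¹ *ᵥ y)
  rw [mulVec_mulVec, mul_nonsing_inv _ ((isUnit_iff_isUnit_det _).mp hunit), one_mulVec] at h
  have hCy : 0 ≤ C * euclNorm y := mul_nonneg hC0 (euclNorm_nonneg y)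
  calc euclNorm ((S * U)⁻¹ *ᵥ y) ≤ 1 / |ρ| * (C * euclNorm y) := by
        rw [one_div, ← div_eq_inv_mul, le_div_iff₀ hρ0]
        linarith
    _ ≤ √((p : ℝ) - r + 1) / sigmaMin U * (C * euclNorm y) := by
        refine mul_le_mul_of_nonneg_right ?_ hCy
        rw [div_le_div_iff₀ hρ0 hσ]
        linarith
    _ = _ := by ring
end
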